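/- In the invertible setting with γ := essinf β > 1, if g ∈ L¹(P) satisfies g(ω) + (Sg)(ω) = 1 for P-a.e. ω ∈ Ω, then g satisfies the functional equation g(ω) = (Tg)(ω) = ∑_{n=1}^∞ (d_n(θ^{−n}ω, 1)/β^{(n)}_{θ^{−n}ω}) · g(θ^{−n}ω) for P-a.e. ω. -/

import Mathlib

open MeasureTheory Filter

/-- The forward orbit of `1`: `orb β θ ω n = τ_ω^n(1)` where `τ_ω = T_{β(ω)}`,
`τ_ω^n = τ_{θ^{n-1}ω} ∘ ⋯ ∘ τ_ω` and `T_α y = Int.fract (α * y)`. -/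
noncomputable def orb {Ω : Type*} (β : Ω → ℝ) (θ : Ω → Ω) (ω : Ω) : ℕ → ℝ
  | 0 => 1
  | n + 1 => Int.fract (β (θ^[n] ω) * orb β θ ω n)

/-- `bprod β θ ω n = β_ω^{(n)} = ∏_{i=0}^{n-1} β (θ^i ω)`. -/
noncomputable def bprod {Ω : Type*} (β : Ω → ℝ) (θ : Ω → Ω) (ω : Ω) (n : ℕ) : ℝ :=
  ∏ i ∈ Finset.range n, β (θ^[i] ω)

/-- `Tcoef β θ ω n = d_{n+1}(ω, 1) / β_ω^{(n+1)}`, where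
`d_{n+1}(ω, 1) = ⌊β(θ^n ω) · τ_ω^n(1)⌋`. -/
noncomputable def Tcoef {Ω : Type*} (β : Ω → ℝ) (θ : Ω → Ω) (ω : Ω) (n : ℕ) : ℝ :=
  (⌊β (θ^[n] ω) * orb β θ ω n⌋ : ℝ) / bprod β θ ω (n + 1)

/-- `Scoef β θ ω n = τ_ω^{n+1}(1) / β_ω^{(n+1)}`. -/
noncomputable def Scoef {Ω : Type*} (β : Ω → ℝ) (θ : Ω → Ω) (ω : Ω) (n : ℕ) : ℝ :=
  orb β θ ω (n + 1) / bprod β θ ω (n + 1)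

/-- The operator `T`: `(Tf)(ω) = ∑_{n=1}^∞ (d_n(θ^{-n}ω, 1)/β^{(n)}_{θ^{-n}ω}) f(θ^{-n}ω)`,
with `θ^{-n}` realized by iterating the inverse `θinv`. -/
noncomputable def TOp {Ω : Type*} (β : Ω → ℝ) (θ θinv : Ω → Ω) (f : Ω → ℝ) (ω : Ω) : ℝ :=
  ∑' n : ℕ, Tcoef β θ (θinv^[n + 1] ω) n * f (θinv^[n + 1] ω)

/-- The operator `S`: `(Sf)(ω) = ∑_{n=1}^∞ (τ^n_{θ^{-n}ω}(1)/β^{(n)}_{θ^{-n}ω}) f(θ^{-n}ω)`. -/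
noncomputable def SOp {Ω : Type*} (β : Ω → ℝ) (θ θinv : Ω → Ω) (f : Ω → ℝ) (ω : Ω) : ℝ :=
  ∑' n : ℕ, Scoef β θ (θinv^[n + 1] ω) n * f (θinv^[n + 1] ω)

section Orbit

variable {Ω : Type*} (β : Ω → ℝ) (θ θinv : Ω → Ω)

lemma orb_mem_Icc (ω : Ω) (n : ℕ) : orb β θ ω n ∈ Set.Icc (0 : ℝ) 1 := by
  cases n with
  | zero => simp [orb]
  | succ n => exact ⟨Int.fract_nonneg _, (Int.fract_lt_one _).le⟩

lemma bprod_succ (ω : Ω) (n : ℕ) :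
    bprod β θ ω (n + 1) = bprod β θ ω n * β (θ^[n] ω) :=
  Finset.prod_range_succ _ _

/-- The digit coefficients telescope. -/
lemma Tcoef_eq_sub_Scoef (hβ : ∀ ω, 0 < β ω) (ω : Ω) (n : ℕ) :
    Tcoef β θ ω n = orb β θ ω n / bprod β θ ω n - Scoef β θ ω n := by
  have hb : β (θ^[n] ω) ≠ 0 := (hβ _).ne'
  have hp : bprod β θ ω n ≠ 0 := Finset.prod_ne_zero_iff.mpr fun i _ ↦ (hβ _).ne'
  have hfract := Int.floor_add_fract (β (θ^[n] ω) * orb β θ ω n)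
  rw [Tcoef, Scoef, bprod_succ, orb]
  field_simp
  linarith

variable {β θ θinv}

lemma pow_le_bprod_iterate {c : ℝ} (hc : 0 ≤ c) (hri : Function.RightInverse θinv θ) {ω : Ω}
    (hω : ∀ k : ℕ, c ≤ β (θinv^[k] ω)) (n : ℕ) : c ^ n ≤ bprod β θ (θinv^[n] ω) n := by
  calc c ^ n = ∏ _i ∈ Finset.range n, c := by simp
    _ ≤ _ := by
      refine Finset.prod_le_prod (fun _ _ ↦ hc) fun i hi ↦ ?_
      have hin : i ≤ n := (Finset.mem_range.mp hi).le
      obtain ⟨k, rfl⟩ := Nat.exists_eq_add_of_le hin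
      rw [Function.iterate_add_apply, hri.iterate i]
      exact hω k

lemma norm_orb_div_bprod_le {c : ℝ} (hc : 0 < c) (hri : Function.RightInverse θinv θ) {ω : Ω}
    (hω : ∀ k : ℕ, c ≤ β (θinv^[k] ω)) (n : ℕ) :
    ‖orb β θ (θinv^[n] ω) n / bprod β θ (θinv^[n] ω) n‖ ≤ c⁻¹ ^ n := by
  have h1 := pow_le_bprod_iterate hc.le hri hω n
  have hp : 0 < c ^ n := pow_pos hc n
  obtain ⟨h0, hle⟩ := orb_mem_Icc β θ (θinv^[n] ω) n
  rw [Real.norm_of_nonneg (div_nonneg h0 (hp.le.trans h1)), inv_pow, ← one_div]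
  exact div_le_div₀ zero_le_one hle hp h1

end Orbit

section Measure

variable {Ω : Type*} [MeasurableSpace Ω] {P : Measure Ω}

lemma exists_gt_ae_le_of_lt_essInf {f : Ω → ℝ} (hf : ∀ ω, 0 < f ω) {a : ℝ}
    (ha : a < essInf f P) : ∃ c, a < c ∧ ∀ᵐ ω ∂P, c ≤ f ω := by
  rw [essInf, liminf_eq] at ha
  have hne : {a : ℝ | ∀ᵐ ω ∂P, a ≤ f ω}.Nonempty :=
    ⟨0, ae_of_all P fun ω ↦ (hf ω).le⟩
  obtain ⟨c, hc, hac⟩ := exists_lt_of_lt_csSup hne ha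
  exact ⟨c, hac, hc⟩

/-- Along the orbit of a measure preserving map, an integrable function is almost everywhere
summable against geometric weights. -/
lemma ae_summable_geometric_mul_comp_iterate {φ : Ω → Ω} (hφ : MeasurePreserving φ P P)
    {g : Ω → ℝ} (hg : Integrable g P) {r : ℝ} (hr0 : 0 ≤ r) (hr1 : r < 1) :
    ∀ᵐ ω ∂P, Summable fun n : ℕ ↦ r ^ n * ‖g (φ^[n] ω)‖ := by
  have hint (n : ℕ) : Integrable (fun ω ↦ g (φ^[n] ω)) P :=
    (hφ.iterate n).integrable_comp_of_integrable hg
  have hmeas (n : ℕ) : AEMeasurable (fun ω ↦ ENNReal.ofReal r ^ n * ‖g (φ^[n] ω)‖ₑ) P :=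
    (hint n).1.enorm.const_mul _
  have hnorm (n : ℕ) : ∫⁻ ω, ‖g (φ^[n] ω)‖ₑ ∂P = ∫⁻ ω, ‖g ω‖ₑ ∂P := by
    have h := lintegral_map' (μ := P) (f := fun ω ↦ ‖g ω‖ₑ) (g := φ^[n])
      (by rw [(hφ.iterate n).map_eq]; exact hg.1.enorm) (hφ.iterate n).aemeasurable
    rw [(hφ.iterate n).map_eq] at h
    exact h.symm
  have hfin : ∫⁻ ω, ∑' n : ℕ, ENNReal.ofReal r ^ n * ‖g (φ^[n] ω)‖ₑ ∂P ≠ ⊤ := by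
    rw [lintegral_tsum hmeas]
    simp_rw [lintegral_const_mul'' _ (hint _).1.enorm, hnorm, ENNReal.tsum_mul_right]
    refine ENNReal.mul_ne_top ?_ hg.2.ne
    rw [ENNReal.tsum_geometric, ENNReal.inv_ne_top]
    exact (tsub_pos_of_lt (by simpa using hr1)).ne'
  filter_upwards [ae_lt_top' (AEMeasurable.tsum hmeas) hfin] with ω hω
  convert ENNReal.summable_toReal hω.ne using 2 with n
  simp [hr0]

end Measure

/-- In the invertible setting with `γ := essinf β > 1`, if `g ∈ L¹(P)`
satisfies `g + Sg = 1` a.e., then `g` satisfies the functional equation `g = Tg` a.e.,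
i.e. `g(ω) = ∑_{n=1}^∞ (d_n(θ^{-n}ω,1)/β^{(n)}_{θ^{-n}ω}) g(θ^{-n}ω)` for a.e. `ω`. -/
theorem stmt_16 {Ω : Type*} [MeasurableSpace Ω] (P : Measure Ω) [IsProbabilityMeasure P]
    (θ θinv : Ω → Ω) (hθ : MeasurePreserving θ P P) (hθinv : MeasurePreserving θinv P P)
    (hli : Function.LeftInverse θinv θ) (hri : Function.RightInverse θinv θ)
    (β : Ω → ℝ) (hβmeas : Measurable β) (hβpos : ∀ ω, 0 < β ω)
    (hγ : 1 < essInf β P)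
    (g : Ω → ℝ) (hg : Integrable g P)
    (hgS : ∀ᵐ ω ∂P, g ω + SOp β θ θinv g ω = 1) :
    ∀ᵐ ω ∂P, g ω = TOp β θ θinv g ω := by
  obtain ⟨c, hc1, hc⟩ := exists_gt_ae_le_of_lt_essInf hβpos hγ
  have hc0 : 0 < c := one_pos.trans hc1
  have hc_orbit : ∀ᵐ ω ∂P, ∀ k : ℕ, c ≤ β (θinv^[k] ω) :=
    ae_all_iff.mpr fun k ↦ (hθinv.iterate k).quasiMeasurePreserving.ae hc
  have hgeom := ae_summable_geometric_mul_comp_iterate hθinv hg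
    (inv_nonneg.mpr hc0.le) (inv_lt_one_of_one_lt₀ hc1)
  let F : ℕ → Ω → ℝ := fun n ω ↦
    orb β θ (θinv^[n] ω) n / bprod β θ (θinv^[n] ω) n * g (θinv^[n] ω)
  have hF : ∀ᵐ ω ∂P, Summable fun n ↦ F n ω := by
    filter_upwards [hc_orbit, hgeom] with ω hω hs
    refine Summable.of_norm_bounded hs fun n ↦ ?_
    rw [norm_mul]
    gcongr
    exact norm_orb_div_bprod_le hc0 hri hω n
  have hF_zero (ω : Ω) : F 0 ω = g ω := by simp [F, orb, bprod]
  have hF_tsum : ∀ᵐ ω ∂P, ∑' n, F n ω = 1 := by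
    filter_upwards [hF, hgS] with ω hω hS
    rw [hω.tsum_eq_zero_add, hF_zero]
    exact hS
  filter_upwards [hF, hgS, hθinv.quasiMeasurePreserving.ae hF,
    hθinv.quasiMeasurePreserving.ae hF_tsum] with ω hω hS hω' hsum
  have hterm (n : ℕ) : Tcoef β θ (θinv^[n + 1] ω) n * g (θinv^[n + 1] ω) =
      F n (θinv ω) - F (n + 1) ω := by
    rw [Tcoef_eq_sub_Scoef β θ hβpos, sub_mul]
    rfl
  have hshift : ∑' n, F (n + 1) ω = SOp β θ θinv g ω := rfl
  rw [TOp, tsum_congr hterm, hω'.tsum_sub ((summable_nat_add_iff 1).mpr hω), hsum, hshift]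
  linarith
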